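/- Let p ≥ 1, k ≥ 1, and let α_1, ..., α_{k+1} and δ be complex numbers with Re(α_j) > p-1 for j = 1, ..., k+1 and Re(α_{k+1} + δ) > p-1. Let f₂ be the complex matrix-variate type-2 Dirichlet density f₂(X_1,...,X_k) = D̃_k ∏_{j=1}^k det(X_j)^{α_j - p} · det(I + X_1 + ... + X_k)^{-(α_1 + ... + α_{k+1})}, with D̃_k = Γ̃_p(α_1 + ... + α_{k+1}) / ∏_{j=1}^{k+1} Γ̃_p(α_j), supported on tuples of positive definite p×p self-adjoint matrices. Then the Dirichlet average of φ₅(X_1,...,X_k) = det(I + X_1 + ... + X_k)^{-δ} with respect to f₂ equals ( Γ̃_p(α_{k+1} + δ)/Γ̃_p(α_{k+1}) ) · Γ̃_p(α_1 + ... + α_{k+1}) / Γ̃_p(α_1 + ... + α_{k+1} + δ). -/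

import Mathlib

open MeasureTheory Matrix
open scoped ComplexOrder

noncomputable section

/-- Parameter space `ℝ^p × ℂ^{p(p-1)/2}` for `p × p` Hermitian matrices:
the real diagonal entries together with the strictly upper-triangular complex entries. -/
abbrev HermParam (p : ℕ) : Type :=
  (Fin p → ℝ) × ({ q : Fin p × Fin p // q.1 < q.2 } → ℂ)

/-- The linear isomorphism sending the parameters to the corresponding self-adjoint matrix. -/
def toHermMatrix (p : ℕ) (T : HermParam p) : Matrix (Fin p) (Fin p) ℂ :=
  Matrix.of fun i j =>
    if h : i < j then T.2 ⟨(i, j), h⟩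
    else if h' : j < i then (starRingEnd ℂ) (T.2 ⟨(j, i), h'⟩)
    else (T.1 i : ℂ)

noncomputable instance matrixComplexMeasureSpace (m n : ℕ) :
    MeasureSpace (Matrix (Fin m) (Fin n) ℂ) :=
  inferInstanceAs (MeasureSpace (Fin m → Fin n → ℂ))

/-- The Lebesgue measure `μ_p` on Herm(p), realized as a measure on the space of
`p × p` complex matrices: the pushforward of Lebesgue measure on the parameter space
under the linear isomorphism `toHermMatrix p`. -/
def hermLebesgue (p : ℕ) : Measure (Matrix (Fin p) (Fin p) ℂ) :=
  Measure.map (toHermMatrix p) volume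

/-- The complex matrix-variate gamma function
`Γ̃_p(α) = π^{p(p-1)/2} ∏_{j=1}^p Γ(α - j + 1) = π^{p(p-1)/2} ∏_{j=0}^{p-1} Γ(α - j)`. -/
def cGammaP (p : ℕ) (α : ℂ) : ℂ :=
  (Real.pi : ℂ) ^ (p * (p - 1) / 2) * ∏ j : Fin p, Complex.Gamma (α - j)

end

theorem det_restrictScalars_toLin' {n : ℕ} (A : Matrix (Fin n) (Fin n) ℂ) :
    LinearMap.det ((Matrix.toLin' A).restrictScalars ℝ) = Complex.normSq A.det := by
  rw [LinearMap.det_restrictScalars, LinearMap.det_toLin', Algebra.norm_complex_apply]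

theorem integrable_exp_neg_norm_sq : Integrable (fun z : ℂ => Real.exp (-‖z‖ ^ 2)) := by
  have h := Complex.integral_exp_neg_rpow (p := 2) (by norm_num)
  norm_num [Real.rpow_two] at h
  refine Integrable.of_integral_ne_zero ?_
  rw [h]; positivity

theorem integral_exp_neg_norm_sq : ∫ z : ℂ, Real.exp (-‖z‖ ^ 2) = Real.pi := by
  have h := Complex.integral_exp_neg_rpow (p := 2) (by norm_num)
  norm_num [Real.rpow_two] at h
  exact h

theorem integrable_gaussian_and_integral_eq {n : ℕ} (A : Matrix (Fin n) (Fin n) ℂ)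
    (hA : A.det ≠ 0) (c : Fin n → ℂ) :
    Integrable (fun r : Fin n → ℂ => Real.exp (-∑ i, ‖(A *ᵥ r) i + c i‖ ^ 2)) ∧
    ∫ r : Fin n → ℂ, Real.exp (-∑ i, ‖(A *ᵥ r) i + c i‖ ^ 2)
      = Real.pi ^ n / Complex.normSq A.det := by
  set L : (Fin n → ℂ) →ₗ[ℝ] (Fin n → ℂ) := (Matrix.toLin' A).restrictScalars ℝ with hL
  have hdet : LinearMap.det L = Complex.normSq A.det := det_restrictScalars_toLin' A
  have hpos : 0 < Complex.normSq A.det := Complex.normSq_pos.mpr hA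
  have hmap : Measure.map L (volume : Measure (Fin n → ℂ)) =
      ENNReal.ofReal (Complex.normSq A.det)⁻¹ • volume := by
    rw [Measure.map_linearMap_addHaar_eq_smul_addHaar _ (by rw [hdet]; exact hpos.ne'), hdet,
      abs_of_pos (inv_pos.mpr hpos)]
  have hLm : Measurable L := L.continuous_of_finiteDimensional.measurable
  set g : (Fin n → ℂ) → ℝ := fun x => ∏ i, Real.exp (-‖x i + c i‖ ^ 2) with hg
  have hgi : Integrable g := Integrable.fintype_prod
    (fun i => integrable_exp_neg_norm_sq.comp_add_right (c i))
  have hgv : ∫ x, g x = Real.pi ^ n := by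
    rw [hg, integral_fintype_prod_volume_eq_prod (fun i (z : ℂ) => Real.exp (-‖z + c i‖ ^ 2))]
    simp [integral_add_right_eq_self (fun z : ℂ => Real.exp (-‖z‖ ^ 2)),
      integral_exp_neg_norm_sq]
  have hcomp : (fun r : Fin n → ℂ => Real.exp (-∑ i, ‖(A *ᵥ r) i + c i‖ ^ 2)) = g ∘ L := by
    ext r
    simp [hg, hL, ← Real.exp_sum]
  have hgi' : Integrable g (Measure.map L volume) := by
    rw [hmap]; exact hgi.smul_measure ENNReal.ofReal_ne_top
  rw [hcomp]
  refine ⟨(integrable_map_measure hgi'.1 hLm.aemeasurable).mp hgi', ?_⟩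
  have := integral_map hLm.aemeasurable hgi'.1
  simp only [Function.comp_def]
  rw [← this, hmap, integral_smul_measure, hgv,
    ENNReal.toReal_ofReal (inv_pos.mpr hpos).le, smul_eq_mul]
  ring

theorem integrable_cpow_mul_exp_and_integral_eq {a : ℂ} {r : ℝ} (ha : 0 < a.re) (hr : 0 < r) :
    IntegrableOn (fun t : ℝ => (t : ℂ) ^ (a - 1) * (Real.exp (-(r * t)) : ℂ)) (Set.Ioi 0) ∧
    ∫ t in Set.Ioi (0 : ℝ), (t : ℂ) ^ (a - 1) * (Real.exp (-(r * t)) : ℂ)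
      = (r : ℂ) ^ (-a) * Complex.Gamma a := by
  constructor
  · have h := integrableOn_rpow_mul_exp_neg_mul_rpow (p := 1) (s := a.re - 1) (b := r)
      (by linarith) one_pos hr
    refine Integrable.mono' h ?_ ?_
    · refine ContinuousOn.aestronglyMeasurable ?_ measurableSet_Ioi
      refine ContinuousOn.mul ?_ (by fun_prop)
      refine ContinuousOn.cpow_const (by fun_prop) ?_
      intro t ht
      exact Complex.ofReal_mem_slitPlane.mpr ht
    · filter_upwards [ae_restrict_mem measurableSet_Ioi] with t ht
      rw [norm_mul, Complex.norm_cpow_eq_rpow_re_of_pos ht, Complex.norm_real,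
        Real.norm_of_nonneg (Real.exp_pos _).le]
      simp
  · have h := Complex.integral_cpow_mul_exp_neg_mul_Ioi ha hr
    push_cast
    rw [h, one_div, Complex.inv_cpow, Complex.cpow_neg]
    rw [Complex.arg_ofReal_of_nonneg hr.le]
    exact Real.pi_pos.ne

/-- The factor of the matrix gamma integrand carried by the first row `(y, r)` of the matrix. -/
noncomputable def pivotFactor {n : ℕ} (s : ℂ) (z : ℝ) (B : Matrix (Fin n) (Fin n) ℂ) (c : Fin n → ℂ)
    (x : ℝ × (Fin n → ℂ)) : ℂ :=
  if 0 < x.1 then (x.1 : ℂ) ^ (s - (n + 1 : ℕ)) *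
    (Real.exp (-(z * x.1 + 2 * (star c ⬝ᵥ B *ᵥ x.2).re + (∑ i, ‖(B *ᵥ x.2) i‖ ^ 2) / x.1)) : ℂ)
  else 0

theorem norm_sq_smul_add (a c : ℂ) {y : ℝ} (hy : 0 < y) :
    ‖(Real.sqrt y : ℂ)⁻¹ * a + Real.sqrt y * c‖ ^ 2
      = ‖a‖ ^ 2 / y + 2 * (star c * a).re + y * ‖c‖ ^ 2 := by
  have h : Real.sqrt y ^ 2 = y := Real.sq_sqrt hy.le
  have h0 : Real.sqrt y ≠ 0 := (Real.sqrt_pos.mpr hy).ne'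
  rw [← Complex.ofReal_inv]
  simp only [← Complex.normSq_eq_norm_sq, Complex.normSq_apply, Complex.add_re, Complex.add_im,
    Complex.mul_re, Complex.mul_im, Complex.ofReal_re, Complex.ofReal_im, Complex.star_def,
    Complex.conj_re, Complex.conj_im]
  generalize Real.sqrt y = q at *
  subst h
  field_simp
  ring

theorem integrable_pivot_fiber_and_integral_eq {n : ℕ} (z : ℝ) {B : Matrix (Fin n) (Fin n) ℂ}
    (hB : B.det ≠ 0) (c : Fin n → ℂ) {y : ℝ} (hy : 0 < y) :
    Integrable (fun r : Fin n → ℂ => Real.exp (-(z * y + 2 * (star c ⬝ᵥ B *ᵥ r).re +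
        (∑ i, ‖(B *ᵥ r) i‖ ^ 2) / y))) ∧
    ∫ r : Fin n → ℂ, Real.exp (-(z * y + 2 * (star c ⬝ᵥ B *ᵥ r).re +
        (∑ i, ‖(B *ᵥ r) i‖ ^ 2) / y))
      = Real.pi ^ n / Complex.normSq B.det *
        (y ^ n * Real.exp (-((z - ∑ i, ‖c i‖ ^ 2) * y))) := by
  have hq : (Real.sqrt y : ℂ) ≠ 0 := Complex.ofReal_ne_zero.mpr (Real.sqrt_pos.mpr hy).ne'
  have hdet : (((Real.sqrt y : ℂ)⁻¹) • B).det ≠ 0 := by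
    rw [det_smul]; exact mul_ne_zero (pow_ne_zero _ (inv_ne_zero hq)) hB
  obtain ⟨hi, hv⟩ := integrable_gaussian_and_integral_eq _ hdet (fun i => Real.sqrt y * c i)
  have key : ∀ r : Fin n → ℂ, Real.exp (-(z * y + 2 * (star c ⬝ᵥ B *ᵥ r).re +
        (∑ i, ‖(B *ᵥ r) i‖ ^ 2) / y)) = Real.exp (-((z - ∑ i, ‖c i‖ ^ 2) * y)) *
      Real.exp (-∑ i, ‖((((Real.sqrt y : ℂ)⁻¹) • B) *ᵥ r) i + Real.sqrt y * c i‖ ^ 2) := by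
    intro r
    rw [← Real.exp_add]
    congr 1
    simp only [smul_mulVec, Pi.smul_apply, smul_eq_mul, norm_sq_smul_add _ _ hy,
      Finset.sum_add_distrib, ← Finset.mul_sum, ← Finset.sum_div, dotProduct, Complex.re_sum,
      Pi.star_apply]
    ring
  simp_rw [key]
  refine ⟨hi.const_mul _, ?_⟩
  rw [integral_const_mul, hv, det_smul, map_mul, map_pow, map_inv₀, Complex.normSq_ofReal,
    Real.mul_self_sqrt hy.le, Fintype.card_fin]
  have := (Complex.normSq_pos.mpr hB).ne'
  rw [inv_pow]
  field_simp

theorem measurable_pivotFactor {n : ℕ} (s : ℂ) (z : ℝ) (B : Matrix (Fin n) (Fin n) ℂ)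
    (c : Fin n → ℂ) : Measurable (pivotFactor s z B c) := by
  unfold pivotFactor
  refine Measurable.ite (measurableSet_lt measurable_const measurable_fst) ?_ measurable_const
  simp only [dotProduct, mulVec]
  fun_prop

theorem norm_pivotFactor {n : ℕ} (s : ℂ) (z : ℝ) (B : Matrix (Fin n) (Fin n) ℂ)
    (c : Fin n → ℂ) {y : ℝ} (hy : 0 < y) (r : Fin n → ℂ) :
    ‖pivotFactor s z B c (y, r)‖ = y ^ (s.re - (n + 1 : ℕ)) *
      Real.exp (-(z * y + 2 * (star c ⬝ᵥ B *ᵥ r).re + (∑ i, ‖(B *ᵥ r) i‖ ^ 2) / y)) := by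
  simp only [pivotFactor, hy, if_true]
  rw [norm_mul, Complex.norm_cpow_eq_rpow_re_of_pos hy, Complex.norm_real,
    Real.norm_of_nonneg (Real.exp_pos _).le]
  simp

theorem integrable_pivotFactor_and_integral_eq {n : ℕ} {s : ℂ} (hs : 0 < s.re) {z : ℝ}
    {B : Matrix (Fin n) (Fin n) ℂ} (hB : B.det ≠ 0) {c : Fin n → ℂ}
    (hz : 0 < z - ∑ i, ‖c i‖ ^ 2) :
    Integrable (pivotFactor s z B c) ∧
    ∫ x, pivotFactor s z B c x = (Real.pi : ℂ) ^ n / Complex.normSq B.det *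
      (((z - ∑ i, ‖c i‖ ^ 2 : ℝ) : ℂ) ^ (-s) * Complex.Gamma s) := by
  set κ := z - ∑ i, ‖c i‖ ^ 2 with hκ
  obtain ⟨hgi, hgv⟩ := integrable_cpow_mul_exp_and_integral_eq hs hz
  have hinteg : Integrable (pivotFactor s z B c) := by
    rw [Measure.volume_eq_prod, integrable_prod_iff (measurable_pivotFactor ..).aestronglyMeasurable]
    constructor
    · refine ae_of_all _ fun y => ?_
      by_cases hy : 0 < y
      · simp only [pivotFactor, hy, if_true]
        exact ((integrable_pivot_fiber_and_integral_eq z hB c hy).1.ofReal).const_mul _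
      · simp [pivotFactor, hy]
    · have h1 : (fun y : ℝ => ∫ r, ‖pivotFactor s z B c (y, r)‖) =
          (Set.Ioi 0).indicator (fun y : ℝ => Real.pi ^ n / Complex.normSq B.det *
            ‖(y : ℂ) ^ (s - 1) * (Real.exp (-(κ * y)) : ℂ)‖) := by
        ext y
        by_cases hy : 0 < y
        · rw [Set.indicator_of_mem (Set.mem_Ioi.mpr hy)]
          simp_rw [norm_pivotFactor s z B c hy]
          rw [integral_const_mul, (integrable_pivot_fiber_and_integral_eq z hB c hy).2, norm_mul,
            Complex.norm_cpow_eq_rpow_re_of_pos hy, Complex.norm_real,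
            Real.norm_of_nonneg (Real.exp_pos _).le]
          have : y ^ ((s - 1).re) = y ^ (s.re - (n + 1 : ℕ)) * y ^ n := by
            rw [← Real.rpow_natCast, ← Real.rpow_add hy]
            congr 1
            push_cast
            simp only [Complex.sub_re, Complex.one_re]
            ring
          rw [this]
          ring
        · simp [pivotFactor, hy]
      rw [h1]
      exact (IntegrableOn.integrable_indicator (hgi.norm.const_mul _) measurableSet_Ioi)
  refine ⟨hinteg, ?_⟩
  rw [Measure.volume_eq_prod, integral_prod _ hinteg, ← hgv, ← integral_const_mul,
    ← integral_indicator measurableSet_Ioi]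
  congr 1
  ext y
  by_cases hy : 0 < y
  · rw [Set.indicator_of_mem (Set.mem_Ioi.mpr hy)]
    simp only [pivotFactor, hy, if_true]
    rw [integral_const_mul, integral_complex_ofReal,
      (integrable_pivot_fiber_and_integral_eq z hB c hy).2, ← hκ]
    have hy' : (y : ℂ) ≠ 0 := Complex.ofReal_ne_zero.mpr hy.ne'
    have : (y : ℂ) ^ (s - 1) = (y : ℂ) ^ (s - (n + 1 : ℕ)) * (y : ℂ) ^ n := by
      rw [← Complex.cpow_natCast, ← Complex.cpow_add _ _ hy']
      congr 1
      push_cast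
      ring
    rw [this]
    push_cast
    ring
  · simp [pivotFactor, hy]

/-- Strictly upper-triangular index pairs in size `n + 1`: the first row, and the rest. -/
noncomputable def upperPairEquiv (n : ℕ) : Fin n ⊕ { q : Fin n × Fin n // q.1 < q.2 } ≃
    { q : Fin (n + 1) × Fin (n + 1) // q.1 < q.2 } :=
  Equiv.ofBijective
    (Sum.elim (fun j => ⟨(0, j.succ), Fin.succ_pos j⟩)
      (fun q => ⟨(q.1.1.succ, q.1.2.succ), Fin.succ_lt_succ_iff.mpr q.2⟩)) (by
    constructor
    · rintro (a | ⟨⟨a, b⟩, h⟩) (c | ⟨⟨c, d⟩, h'⟩) <;> simp [Fin.succ_ne_zero, (Fin.succ_ne_zero _).symm]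
    · rintro ⟨⟨a, b⟩, h⟩
      induction b using Fin.cases with
      | zero => exact absurd h (Fin.not_lt_zero a)
      | succ b =>
        induction a using Fin.cases with
        | zero => exact ⟨Sum.inl b, rfl⟩
        | succ a => exact ⟨Sum.inr ⟨(a, b), Fin.succ_lt_succ_iff.mp h⟩, rfl⟩)

/-- Assemble the parameters of a Hermitian matrix from its first row and the remaining block. -/
noncomputable def hermCons (n : ℕ) (x : (ℝ × (Fin n → ℂ)) × HermParam n) : HermParam (n + 1) :=
  ((MeasurableEquiv.piFinSuccAbove (fun _ : Fin (n + 1) => ℝ) 0).symm (x.1.1, x.2.1),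
    MeasurableEquiv.piCongrLeft (fun _ => ℂ) (upperPairEquiv n)
      ((MeasurableEquiv.sumPiEquivProdPi fun _ => ℂ).symm (x.1.2, x.2.2)))

/-- The Hermitian rank-one matrix `r* r / y`, in coordinates. -/
noncomputable def rankOneParam (n : ℕ) (x : ℝ × (Fin n → ℂ)) : HermParam n :=
  (fun i => Complex.normSq (x.2 i) / x.1,
    fun q => (starRingEnd ℂ) (x.2 q.1.1) * x.2 q.1.2 / x.1)

/-- Schur coordinates: first row and Schur complement of the corner entry. -/
noncomputable def schurParam (n : ℕ) (x : (ℝ × (Fin n → ℂ)) × HermParam n) :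
    HermParam (n + 1) :=
  hermCons n (x.1, x.2 + rankOneParam n x.1)

theorem measurePreserving_prodProdProdComm {α β γ δ : Type*} [MeasureSpace α] [MeasureSpace β]
    [MeasureSpace γ] [MeasureSpace δ] [SigmaFinite (volume : Measure α)]
    [SigmaFinite (volume : Measure β)] [SigmaFinite (volume : Measure γ)]
    [SigmaFinite (volume : Measure δ)] :
    MeasurePreserving (fun x : (α × β) × (γ × δ) => ((x.1.1, x.2.1), (x.1.2, x.2.2))) := by
  have h1 : MeasurePreserving (MeasurableEquiv.prodAssoc : (α × β) × (γ × δ) ≃ᵐ _) :=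
    volume_preserving_prodAssoc
  have h2 : MeasurePreserving (MeasurableEquiv.prodAssoc : (β × γ) × δ ≃ᵐ _) :=
    volume_preserving_prodAssoc
  have h3 : MeasurePreserving (MeasurableEquiv.prodAssoc : (γ × β) × δ ≃ᵐ _) :=
    volume_preserving_prodAssoc
  have h4 : MeasurePreserving (MeasurableEquiv.prodAssoc : (α × γ) × (β × δ) ≃ᵐ _) :=
    volume_preserving_prodAssoc
  have h5 : MeasurePreserving (Prod.swap : β × γ → γ × β) := Measure.measurePreserving_swap
  exact h4.symm.comp (((MeasurePreserving.id volume).prod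
    (h3.comp ((h5.prod (MeasurePreserving.id volume)).comp h2.symm))).comp h1)

theorem measurePreserving_hermCons (n : ℕ) : MeasurePreserving (hermCons n) := by
  have h1 := (volume_preserving_piFinSuccAbove (fun _ : Fin (n + 1) => ℝ) 0).symm
  have h2 := (volume_measurePreserving_piCongrLeft (fun _ => ℂ) (upperPairEquiv n)).comp
    (volume_measurePreserving_sumPiEquivProdPi_symm
      (fun _ : Fin n ⊕ { q : Fin n × Fin n // q.1 < q.2 } => ℂ))
  exact (h1.prod h2).comp measurePreserving_prodProdProdComm

theorem measurable_rankOneParam (n : ℕ) : Measurable (rankOneParam n) := by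
  unfold rankOneParam
  refine Measurable.prodMk ?_ ?_
  · refine measurable_pi_lambda _ fun i => ?_
    exact (Complex.continuous_normSq.measurable.comp (by fun_prop)).div measurable_fst
  · refine measurable_pi_lambda _ fun q => ?_
    exact ((Complex.continuous_conj.measurable.comp (by fun_prop)).mul (by fun_prop)).div
      (by fun_prop)

theorem measurePreserving_schurParam (n : ℕ) : MeasurePreserving (schurParam n) := by
  refine (measurePreserving_hermCons n).comp ?_
  refine (MeasurePreserving.id (volume : Measure (ℝ × (Fin n → ℂ)))).skew_product
    (g := fun x T => T + rankOneParam n x) ?_ ?_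
  · exact measurable_snd.add ((measurable_rankOneParam n).comp measurable_fst)
  · exact ae_of_all _ fun x => ((measurePreserving_add_right volume (rankOneParam n x).1).prod
      (measurePreserving_add_right volume (rankOneParam n x).2)).map_eq

@[simp]
theorem hermCons_fst_zero {n : ℕ} (x : (ℝ × (Fin n → ℂ)) × HermParam n) :
    (hermCons n x).1 0 = x.1.1 := rfl

@[simp]
theorem hermCons_fst_succ {n : ℕ} (x : (ℝ × (Fin n → ℂ)) × HermParam n) (i : Fin n) :
    (hermCons n x).1 i.succ = x.2.1 i := rfl

@[simp]
theorem hermCons_snd_zero {n : ℕ} (x : (ℝ × (Fin n → ℂ)) × HermParam n) (j : Fin n)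
    (h : (0 : Fin (n + 1)) < j.succ) : (hermCons n x).2 ⟨(0, j.succ), h⟩ = x.1.2 j :=
  Equiv.piCongrLeft_apply_apply (fun _ => ℂ) (upperPairEquiv n) _ (Sum.inl j)

@[simp]
theorem hermCons_snd_succ {n : ℕ} (x : (ℝ × (Fin n → ℂ)) × HermParam n) (i j : Fin n)
    (h : i.succ < j.succ) : (hermCons n x).2 ⟨(i.succ, j.succ), h⟩ =
      x.2.2 ⟨(i, j), Fin.succ_lt_succ_iff.mp h⟩ :=
  Equiv.piCongrLeft_apply_apply (fun _ => ℂ) (upperPairEquiv n) _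
    (Sum.inr ⟨(i, j), Fin.succ_lt_succ_iff.mp h⟩)

theorem toHermMatrix_schurParam_zero_zero {n : ℕ} (y : ℝ) (r : Fin n → ℂ) (T : HermParam n) :
    toHermMatrix (n + 1) (schurParam n ((y, r), T)) 0 0 = y := by
  simp [toHermMatrix, schurParam]

theorem toHermMatrix_schurParam_zero_succ {n : ℕ} (y : ℝ) (r : Fin n → ℂ) (T : HermParam n)
    (j : Fin n) : toHermMatrix (n + 1) (schurParam n ((y, r), T)) 0 j.succ = r j := by
  simp [toHermMatrix, schurParam]

theorem toHermMatrix_schurParam_succ_zero {n : ℕ} (y : ℝ) (r : Fin n → ℂ) (T : HermParam n)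
    (i : Fin n) : toHermMatrix (n + 1) (schurParam n ((y, r), T)) i.succ 0 = star (r i) := by
  simp [toHermMatrix, schurParam]

theorem toHermMatrix_schurParam_succ_succ {n : ℕ} (y : ℝ) (r : Fin n → ℂ) (T : HermParam n)
    (i j : Fin n) : toHermMatrix (n + 1) (schurParam n ((y, r), T)) i.succ j.succ =
      toHermMatrix n T i j + star (r i) * r j / y := by
  rcases lt_trichotomy i j with h | rfl | h
  · simp [toHermMatrix, schurParam, h, rankOneParam]
  · simp [toHermMatrix, schurParam, rankOneParam, Complex.normSq_eq_conj_mul_self]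
  · simp [toHermMatrix, schurParam, h, h.not_gt, rankOneParam, mul_comm]

/-- Splitting off the index `0`. -/
def cornerEquiv (n : ℕ) : PUnit.{1} ⊕ Fin n ≃ Fin (n + 1) :=
  ((Equiv.sumComm _ _).trans (Equiv.optionEquivSumPUnit (Fin n)).symm).trans (finSuccEquiv n).symm

@[simp]
theorem cornerEquiv_inl (n : ℕ) (u : PUnit) : cornerEquiv n (Sum.inl u) = 0 := by
  simp [cornerEquiv]

@[simp]
theorem cornerEquiv_inr (n : ℕ) (i : Fin n) : cornerEquiv n (Sum.inr i) = i.succ := by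
  simp [cornerEquiv]

theorem toHermMatrix_schurParam_submatrix {n : ℕ} {y : ℝ} (hy : 0 < y) (r : Fin n → ℂ)
    (T : HermParam n) :
    (toHermMatrix (n + 1) (schurParam n ((y, r), T))).submatrix (cornerEquiv n) (cornerEquiv n) =
      fromBlocks ((y : ℂ) • 1) (replicateRow PUnit r) (replicateRow PUnit r)ᴴ
        (toHermMatrix n T +
          (replicateRow PUnit r)ᴴ * ((y : ℂ) • (1 : Matrix PUnit PUnit ℂ))⁻¹ *
            replicateRow PUnit r) := by
  have hinv : ((y : ℂ) • (1 : Matrix PUnit PUnit ℂ))⁻¹ = (y : ℂ)⁻¹ • 1 := by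
    refine inv_eq_right_inv ?_
    rw [smul_mul_smul_comm, one_mul,
      mul_inv_cancel₀ (Complex.ofReal_ne_zero.mpr hy.ne'), one_smul]
  rw [hinv]
  ext (i | i) (j | j)
  · simp [toHermMatrix_schurParam_zero_zero]
  · simp [toHermMatrix_schurParam_zero_succ]
  · simp [toHermMatrix_schurParam_succ_zero]
  · simp [toHermMatrix_schurParam_succ_succ, Matrix.mul_apply]
    ring

theorem det_toHermMatrix_schurParam {n : ℕ} {y : ℝ} (hy : 0 < y) (r : Fin n → ℂ)
    (T : HermParam n) :
    (toHermMatrix (n + 1) (schurParam n ((y, r), T))).det = y * (toHermMatrix n T).det := by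
  have hu : IsUnit ((y : ℂ) • (1 : Matrix PUnit PUnit ℂ)) := by
    rw [isUnit_iff_isUnit_det]
    simpa using hy.ne'
  let := hu.invertible
  rw [← det_submatrix_equiv_self (cornerEquiv n), toHermMatrix_schurParam_submatrix hy,
    det_fromBlocks₁₁, invOf_eq_nonsing_inv, add_sub_cancel_right]
  simp

theorem posDef_toHermMatrix_schurParam {n : ℕ} {y : ℝ} (hy : 0 < y) (r : Fin n → ℂ)
    (T : HermParam n) :
    (toHermMatrix (n + 1) (schurParam n ((y, r), T))).PosDef ↔ (toHermMatrix n T).PosDef := by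
  have hA : ((y : ℂ) • (1 : Matrix PUnit PUnit ℂ)).PosDef :=
    PosDef.one.smul (by exact_mod_cast hy)
  let := hA.isUnit.invertible
  have hpsd : (toHermMatrix (n + 1) (schurParam n ((y, r), T))).PosSemidef ↔
      (toHermMatrix n T).PosSemidef := by
    rw [← posSemidef_submatrix_equiv (cornerEquiv n), toHermMatrix_schurParam_submatrix hy,
      hA.fromBlocks₁₁, add_sub_cancel_right]
  have hy' : (y : ℂ) ≠ 0 := Complex.ofReal_ne_zero.mpr hy.ne'
  constructor
  · intro h
    rw [(hpsd.mp h.posSemidef).posDef_iff_det_ne_zero]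
    intro h0
    apply h.det_pos.ne'
    rw [det_toHermMatrix_schurParam hy, h0, mul_zero]
  · intro h
    rw [(hpsd.mpr h.posSemidef).posDef_iff_det_ne_zero, det_toHermMatrix_schurParam hy]
    exact mul_ne_zero hy' h.det_pos.ne'

theorem pos_of_posDef_toHermMatrix_schurParam {n : ℕ} {y : ℝ} {r : Fin n → ℂ} {T : HermParam n}
    (h : (toHermMatrix (n + 1) (schurParam n ((y, r), T))).PosDef) : 0 < y := by
  have := h.diag_pos (i := 0)
  rw [toHermMatrix_schurParam_zero_zero] at this
  exact_mod_cast this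

open scoped MatrixOrder in
theorem exists_factor_of_posDef {n : ℕ} {Z : Matrix (Fin (n + 1)) (Fin (n + 1)) ℂ}
    (hZ : Z.PosDef) : ∃ (B : Matrix (Fin n) (Fin n) ℂ) (c : Fin n → ℂ), B.det ≠ 0 ∧
      Z.submatrix Fin.succ Fin.succ = Bᴴ * B ∧ ∀ j : Fin n, Z j.succ 0 = (Bᴴ *ᵥ c) j := by
  have hZ' : (Z.submatrix Fin.succ Fin.succ).PosDef := hZ.submatrix (Fin.succ_injective n)
  obtain ⟨B, hB⟩ := CStarAlgebra.nonneg_iff_eq_star_mul_self.mp hZ'.posSemidef.nonneg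
  rw [star_eq_conjTranspose] at hB
  have hdet : B.det ≠ 0 := by
    intro h
    apply hZ'.det_pos.ne'
    rw [hB, det_mul, h, mul_zero]
  refine ⟨B, Bᴴ⁻¹ *ᵥ fun j => Z j.succ 0, hdet, hB, fun j => ?_⟩
  rw [mulVec_mulVec, mul_nonsing_inv, one_mulVec]
  rw [det_conjTranspose]
  exact (star_ne_zero.mpr hdet).isUnit

theorem det_eq_of_factor {n : ℕ} {Z : Matrix (Fin (n + 1)) (Fin (n + 1)) ℂ}
    (hZ : Z.IsHermitian) {B : Matrix (Fin n) (Fin n) ℂ} {c : Fin n → ℂ} (hB : B.det ≠ 0)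
    (hZB : Z.submatrix Fin.succ Fin.succ = Bᴴ * B) (hc : ∀ j : Fin n, Z j.succ 0 = (Bᴴ *ᵥ c) j) :
    Z.det = Complex.normSq B.det * ((Z 0 0).re - ∑ i, ‖c i‖ ^ 2 : ℝ) := by
  have hBu : IsUnit B.det := hB.isUnit
  have hBu' : IsUnit Bᴴ.det := by rw [det_conjTranspose]; exact (star_ne_zero.mpr hB).isUnit
  have hsub : Z.submatrix (cornerEquiv n) (cornerEquiv n) =
      fromBlocks (of fun _ _ => Z 0 0) ((replicateCol PUnit c)ᴴ * B) (Bᴴ * replicateCol PUnit c)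
        (Bᴴ * B) := by
    ext (i | i) (j | j)
    · simp
    · have h1 : Z 0 j.succ = star (Z j.succ 0) := (hZ.apply 0 j.succ).symm
      simp [h1, hc, mulVec, dotProduct, Matrix.mul_apply, mul_comm]
    · simp [hc, mulVec, dotProduct, Matrix.mul_apply]
    · rw [← hZB]
      simp
  have hu : IsUnit (Bᴴ * B) := by
    rw [isUnit_iff_isUnit_det, det_mul]
    exact hBu'.mul hBu
  let := hu.invertible
  have hprod : (replicateCol PUnit c)ᴴ * B * (Bᴴ * B)⁻¹ * (Bᴴ * replicateCol PUnit c) =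
      (replicateCol PUnit c)ᴴ * replicateCol PUnit c := by
    rw [Matrix.mul_inv_rev]
    simp only [Matrix.mul_assoc]
    rw [nonsing_inv_mul_cancel_left _ _ hBu', mul_nonsing_inv_cancel_left _ _ hBu]
  have h00 : Z 0 0 = ((Z 0 0).re : ℂ) := (hZ.coe_re_apply_self 0).symm
  rw [← det_submatrix_equiv_self (cornerEquiv n), hsub, det_fromBlocks₂₂, invOf_eq_nonsing_inv,
    hprod, det_mul, det_conjTranspose, det_unique (n := PUnit)]
  congr 1
  · rw [Complex.normSq_eq_conj_mul_self]; rfl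
  · rw [Matrix.sub_apply, of_apply, h00]
    simp [Matrix.mul_apply, ← Complex.normSq_eq_norm_sq, Complex.normSq_eq_conj_mul_self]

theorem trace_transpose_mul_eq_sum {n : ℕ} (Z Y : Matrix (Fin n) (Fin n) ℂ) :
    (Zᵀ * Y).trace = ∑ i, ∑ j, Z i j * Y i j := by
  rw [Finset.sum_comm]
  simp [trace, Matrix.mul_apply]

theorem trace_toHermMatrix_schurParam {n : ℕ} {Z : Matrix (Fin (n + 1)) (Fin (n + 1)) ℂ}
    (hZ : Z.IsHermitian) {B : Matrix (Fin n) (Fin n) ℂ} {c : Fin n → ℂ}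
    (hZB : Z.submatrix Fin.succ Fin.succ = Bᴴ * B) (hc : ∀ j : Fin n, Z j.succ 0 = (Bᴴ *ᵥ c) j)
    (y : ℝ) (r : Fin n → ℂ) (T : HermParam n) :
    (Zᵀ * toHermMatrix (n + 1) (schurParam n ((y, r), T))).trace.re =
      ((Z 0 0).re * y + 2 * (star c ⬝ᵥ B *ᵥ r).re + (∑ i, ‖(B *ᵥ r) i‖ ^ 2) / y) +
        ((Bᴴ * B)ᵀ * toHermMatrix n T).trace.re := by
  have hcross : ∑ j : Fin n, Z 0 j.succ * r j = star c ⬝ᵥ B *ᵥ r := by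
    have h1 : (fun j : Fin n => Z 0 j.succ) = star (Bᴴ *ᵥ c) := by
      ext j
      rw [Pi.star_apply, ← hc]
      exact (hZ.apply 0 j.succ).symm
    rw [dotProduct_mulVec, ← conjTranspose_conjTranspose B, ← star_mulVec, ← h1]
    rfl
  have hcross' : ∑ j : Fin n, Z j.succ 0 * star (r j) = star (star c ⬝ᵥ B *ᵥ r) := by
    rw [← hcross, star_sum]
    refine Finset.sum_congr rfl fun j _ => ?_
    rw [star_mul', hZ.apply]
  have hquad : ∑ i : Fin n, ∑ j : Fin n, (Bᴴ * B) i j * (star (r i) * r j / y) =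
      ((∑ i, ‖(B *ᵥ r) i‖ ^ 2) / y : ℝ) := by
    have h1 : star r ⬝ᵥ (Bᴴ * B) *ᵥ r = ((∑ i, ‖(B *ᵥ r) i‖ ^ 2 : ℝ) : ℂ) := by
      rw [← mulVec_mulVec, dotProduct_mulVec, ← star_mulVec]
      simp [dotProduct, ← Complex.normSq_eq_norm_sq, Complex.normSq_eq_conj_mul_self]
    rw [Complex.ofReal_div, ← h1]
    simp only [dotProduct, mulVec, Finset.mul_sum, Finset.sum_div, Pi.star_apply]
    refine Finset.sum_congr rfl fun i _ => Finset.sum_congr rfl fun j _ => ?_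
    ring
  have hsucc : ∀ i j : Fin n, Z i.succ j.succ = (Bᴴ * B) i j := fun i j => by
    rw [← hZB, submatrix_apply]
  rw [trace_transpose_mul_eq_sum, trace_transpose_mul_eq_sum]
  simp only [Fin.sum_univ_succ, toHermMatrix_schurParam_zero_zero,
    toHermMatrix_schurParam_zero_succ, toHermMatrix_schurParam_succ_zero,
    toHermMatrix_schurParam_succ_succ, Finset.sum_add_distrib, mul_add, hcross, hcross', hsucc,
    hquad]
  simp only [Complex.add_re, Complex.re_mul_ofReal, Complex.ofReal_re, Complex.star_def,
    Complex.conj_re]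
  ring

instance borelSpace_matrix_complex (m n : ℕ) : BorelSpace (Matrix (Fin m) (Fin n) ℂ) :=
  inferInstanceAs (BorelSpace (Fin m → Fin n → ℂ))

instance secondCountableTopology_matrix_complex (m n : ℕ) :
    SecondCountableTopology (Matrix (Fin m) (Fin n) ℂ) :=
  inferInstanceAs (SecondCountableTopology (Fin m → Fin n → ℂ))

theorem continuous_toHermMatrix (p : ℕ) : Continuous (toHermMatrix p) := by
  refine continuous_matrix fun i j => ?_
  simp only [toHermMatrix, of_apply]
  split_ifs
  · fun_prop
  · exact Complex.continuous_conj.comp (by fun_prop)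
  · fun_prop

theorem toHermMatrix_injective (p : ℕ) : Function.Injective (toHermMatrix p) := by
  intro S T h
  refine Prod.ext ?_ ?_
  · ext i
    have := congrFun (congrFun h i) i
    simpa [toHermMatrix] using this
  · ext ⟨⟨i, j⟩, hij⟩
    have hij' : i < j := hij
    have := congrFun (congrFun h i) j
    simpa [toHermMatrix, hij'] using this

theorem measurableEmbedding_toHermMatrix (p : ℕ) : MeasurableEmbedding (toHermMatrix p) :=
  (continuous_toHermMatrix p).measurableEmbedding (toHermMatrix_injective p)

instance sigmaFinite_hermLebesgue (p : ℕ) : SigmaFinite (hermLebesgue p) :=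
  (measurableEmbedding_toHermMatrix p).sigmaFinite_map

theorem measurableSet_posDef (p : ℕ) :
    MeasurableSet {Y : Matrix (Fin p) (Fin p) ℂ | Y.PosDef} := by
  have h : {Y : Matrix (Fin p) (Fin p) ℂ | Y.PosDef} =
      ({Y | Yᴴ = Y} ∩ ⋂ x : Fin p → ℂ, {Y | 0 ≤ star x ⬝ᵥ Y *ᵥ x}) ∩ {Y | Y.det = 0}ᶜ := by
    ext Y
    constructor
    · intro hY
      exact ⟨⟨hY.isHermitian, Set.mem_iInter.mpr fun x =>
        hY.posSemidef.dotProduct_mulVec_nonneg x⟩, hY.det_pos.ne'⟩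
    · rintro ⟨⟨h1, h2⟩, h3⟩
      exact (PosSemidef.of_dotProduct_mulVec_nonneg h1
        fun x => Set.mem_iInter.mp h2 x).posDef_iff_det_ne_zero.mpr h3
  rw [h]
  refine MeasurableSet.inter (IsClosed.inter ?_ (isClosed_iInter fun x => ?_)).measurableSet
    (IsClosed.measurableSet ?_).compl
  · exact isClosed_eq (by fun_prop) continuous_id
  · exact isClosed_le continuous_const (by fun_prop)
  · exact isClosed_eq (by fun_prop) continuous_const

open Classical in
/-- The integrand of the matrix-variate gamma integral, with scale matrix `Zᵀ`. -/
noncomputable def matrixGammaIntegrand (p : ℕ) (s : ℂ) (Z Y : Matrix (Fin p) (Fin p) ℂ) : ℂ :=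
  if Y.PosDef then (Y.det.re : ℂ) ^ (s - p) * (Real.exp (-(Zᵀ * Y).trace.re) : ℂ) else 0

theorem matrixGammaIntegrand_of_posDef {p : ℕ} (s : ℂ) (Z : Matrix (Fin p) (Fin p) ℂ)
    {Y : Matrix (Fin p) (Fin p) ℂ} (hY : Y.PosDef) : matrixGammaIntegrand p s Z Y =
      (Y.det.re : ℂ) ^ (s - p) * (Real.exp (-(Zᵀ * Y).trace.re) : ℂ) :=
  if_pos hY

theorem matrixGammaIntegrand_of_not_posDef {p : ℕ} (s : ℂ) (Z : Matrix (Fin p) (Fin p) ℂ)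
    {Y : Matrix (Fin p) (Fin p) ℂ} (hY : ¬ Y.PosDef) : matrixGammaIntegrand p s Z Y = 0 :=
  if_neg hY

theorem measurable_matrixGammaIntegrand_uncurry (p : ℕ) (s : ℂ) :
    Measurable fun x : Matrix (Fin p) (Fin p) ℂ × Matrix (Fin p) (Fin p) ℂ =>
      matrixGammaIntegrand p s x.1 x.2 := by
  have hdet : Measurable fun Y : Matrix (Fin p) (Fin p) ℂ => (Y.det.re : ℂ) :=
    Continuous.measurable (by fun_prop)
  have htr : Measurable fun x : Matrix (Fin p) (Fin p) ℂ × Matrix (Fin p) (Fin p) ℂ =>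
      (Real.exp (-(x.1ᵀ * x.2).trace.re) : ℂ) := Continuous.measurable (by fun_prop)
  refine Measurable.ite (measurable_snd (measurableSet_posDef p)) ?_ measurable_const
  exact ((hdet.comp measurable_snd).pow_const _).mul htr

theorem measurable_matrixGammaIntegrand (p : ℕ) (s : ℂ) (Z : Matrix (Fin p) (Fin p) ℂ) :
    Measurable (matrixGammaIntegrand p s Z) :=
  (measurable_matrixGammaIntegrand_uncurry p s).comp measurable_prodMk_left

theorem cGammaP_succ (n : ℕ) (s : ℂ) :
    cGammaP (n + 1) s = (Real.pi : ℂ) ^ n * Complex.Gamma s * cGammaP n (s - 1) := by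
  unfold cGammaP
  rw [Nat.triangle_succ, pow_add, Fin.prod_univ_succ]
  have : ∀ i : Fin n, s - (i.succ : ℕ) = s - 1 - (i : ℕ) := fun i => by
    push_cast [Fin.val_succ]; ring
  simp_rw [this]
  simp
  ring

theorem Matrix.PosDef.re_det_pos {p : ℕ} {Y : Matrix (Fin p) (Fin p) ℂ} (h : Y.PosDef) :
    0 < Y.det.re := (Complex.pos_iff.mp h.det_pos).1

theorem matrixGammaIntegrand_schurParam {n : ℕ} (s : ℂ)
    {Z : Matrix (Fin (n + 1)) (Fin (n + 1)) ℂ}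
    (hZ : Z.IsHermitian) {B : Matrix (Fin n) (Fin n) ℂ} {c : Fin n → ℂ}
    (hZB : Z.submatrix Fin.succ Fin.succ = Bᴴ * B) (hc : ∀ j : Fin n, Z j.succ 0 = (Bᴴ *ᵥ c) j)
    (x : (ℝ × (Fin n → ℂ)) × HermParam n) :
    matrixGammaIntegrand (n + 1) s Z (toHermMatrix (n + 1) (schurParam n x)) =
      pivotFactor s (Z 0 0).re B c x.1 *
        matrixGammaIntegrand n (s - 1) (Bᴴ * B) (toHermMatrix n x.2) := by
  obtain ⟨⟨y, r⟩, T⟩ := x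
  by_cases hy : 0 < y
  · by_cases hT : (toHermMatrix n T).PosDef
    · have hY := (posDef_toHermMatrix_schurParam hy r T).mpr hT
      rw [matrixGammaIntegrand_of_posDef _ _ hY, matrixGammaIntegrand_of_posDef _ _ hT,
        trace_toHermMatrix_schurParam hZ hZB hc, det_toHermMatrix_schurParam hy]
      simp only [pivotFactor, hy, if_true]
      rw [Complex.re_ofReal_mul, Complex.ofReal_mul,
        Complex.mul_cpow_ofReal_nonneg hy.le hT.re_det_pos.le, neg_add, Real.exp_add]
      have : s - ((n + 1 : ℕ) : ℂ) = s - 1 - n := by push_cast; ring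
      rw [this]
      push_cast
      ring
    · have hY := mt (posDef_toHermMatrix_schurParam hy r T).mp hT
      rw [matrixGammaIntegrand_of_not_posDef _ _ hY, matrixGammaIntegrand_of_not_posDef _ _ hT,
        mul_zero]
  · have hY := mt (pos_of_posDef_toHermMatrix_schurParam (r := r) (T := T)) hy
    rw [matrixGammaIntegrand_of_not_posDef _ _ hY]
    simp [pivotFactor, hy]

theorem integrable_matrixGammaIntegrand_comp_and_integral_eq (p : ℕ) :
    ∀ {s : ℂ}, (p - 1 : ℝ) < s.re → ∀ {Z : Matrix (Fin p) (Fin p) ℂ}, Z.PosDef →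
    Integrable (fun T => matrixGammaIntegrand p s Z (toHermMatrix p T)) ∧
    ∫ T, matrixGammaIntegrand p s Z (toHermMatrix p T) =
      cGammaP p s * (Z.det.re : ℂ) ^ (-s) := by
  induction p with
  | zero =>
    intro s _ Z _
    have h1 : ∀ Y : Matrix (Fin 0) (Fin 0) ℂ, matrixGammaIntegrand 0 s Z Y = 1 := by
      intro Y
      have hY : Y.PosDef := by
        rw [Subsingleton.elim Y 1]
        exact PosDef.one
      rw [matrixGammaIntegrand_of_posDef _ _ hY]
      simp [trace]
    have hvol : (volume : Measure (HermParam 0)) Set.univ = 1 := by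
      rw [Measure.volume_eq_prod, ← Set.univ_prod_univ, Measure.prod_prod]
      simp [volume_pi]
    have : IsProbabilityMeasure (volume : Measure (HermParam 0)) := ⟨hvol⟩
    simp only [h1]
    refine ⟨integrable_const _, ?_⟩
    simp [cGammaP]
  | succ n ih =>
    intro s hs Z hZ
    obtain ⟨B, c, hB, hZB, hc⟩ := exists_factor_of_posDef hZ
    have hs' : (n : ℝ) < s.re := by push_cast at hs; linarith
    have hZ' : (Bᴴ * B).PosDef := hZB ▸ hZ.submatrix (Fin.succ_injective n)
    have hb : 0 < Complex.normSq B.det := Complex.normSq_pos.mpr hB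
    have hdetZ := det_eq_of_factor hZ.isHermitian hB hZB hc
    rw [← Complex.ofReal_mul] at hdetZ
    have hz : 0 < (Z 0 0).re - ∑ i, ‖c i‖ ^ 2 := by
      have := hZ.re_det_pos
      rw [hdetZ, Complex.ofReal_re] at this
      exact (mul_pos_iff_of_pos_left hb).mp this
    have hdet' : ((Bᴴ * B).det.re : ℂ) = Complex.normSq B.det := by
      rw [det_mul, det_conjTranspose, Complex.star_def, ← Complex.normSq_eq_conj_mul_self,
        Complex.ofReal_re]
    obtain ⟨h1, h2⟩ := integrable_pivotFactor_and_integral_eq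
      (s := s) (lt_of_le_of_lt n.cast_nonneg hs') hB hz
    obtain ⟨h3, h4⟩ := ih (s := s - 1) (by simpa using hs') hZ'
    have hmeas : Measurable fun T =>
        matrixGammaIntegrand (n + 1) s Z (toHermMatrix (n + 1) T) :=
      (measurable_matrixGammaIntegrand (n + 1) s Z).comp (continuous_toHermMatrix _).measurable
    have hmp := measurePreserving_schurParam n
    have hcomp : (fun x => matrixGammaIntegrand (n + 1) s Z
        (toHermMatrix (n + 1) (schurParam n x))) = fun x => pivotFactor s (Z 0 0).re B c x.1 *
        matrixGammaIntegrand n (s - 1) (Bᴴ * B) (toHermMatrix n x.2) :=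
      funext (matrixGammaIntegrand_schurParam s hZ.isHermitian hZB hc)
    constructor
    · refine (hmp.integrable_comp hmeas.aestronglyMeasurable).mp ?_
      simp only [Function.comp_def]
      rw [hcomp]
      exact h1.mul_prod h3
    · have hprod := integral_prod_mul (μ := volume) (ν := volume) (pivotFactor s (Z 0 0).re B c)
        fun T => matrixGammaIntegrand n (s - 1) (Bᴴ * B) (toHermMatrix n T)
      rw [← Measure.volume_eq_prod] at hprod
      rw [← hmp.map_eq, integral_map hmp.measurable.aemeasurable hmeas.aestronglyMeasurable,
        hcomp, hprod, h2, h4, hdet', hdetZ, Complex.ofReal_re,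
        Complex.ofReal_mul, Complex.mul_cpow_ofReal_nonneg hb.le hz.le, cGammaP_succ]
      have hb' : (Complex.normSq B.det : ℂ) ≠ 0 := Complex.ofReal_ne_zero.mpr hb.ne'
      rw [show -(s - 1) = -s + 1 by ring, Complex.cpow_add _ _ hb', Complex.cpow_one]
      field_simp

theorem integrable_matrixGammaIntegrand {p : ℕ} {s : ℂ} (hs : (p - 1 : ℝ) < s.re)
    {Z : Matrix (Fin p) (Fin p) ℂ} (hZ : Z.PosDef) :
    Integrable (matrixGammaIntegrand p s Z) (hermLebesgue p) :=
  (measurableEmbedding_toHermMatrix p).integrable_map_iff.mpr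
    (integrable_matrixGammaIntegrand_comp_and_integral_eq p hs hZ).1

theorem integral_matrixGammaIntegrand {p : ℕ} {s : ℂ} (hs : (p - 1 : ℝ) < s.re)
    {Z : Matrix (Fin p) (Fin p) ℂ} (hZ : Z.PosDef) :
    ∫ Y, matrixGammaIntegrand p s Z Y ∂hermLebesgue p =
      cGammaP p s * (Z.det.re : ℂ) ^ (-s) := by
  rw [hermLebesgue, (measurableEmbedding_toHermMatrix p).integral_map]
  exact (integrable_matrixGammaIntegrand_comp_and_integral_eq p hs hZ).2

theorem ofReal_norm_matrixGammaIntegrand (p : ℕ) (s : ℂ) (Z Y : Matrix (Fin p) (Fin p) ℂ) :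
    ((‖matrixGammaIntegrand p s Z Y‖ : ℝ) : ℂ) = matrixGammaIntegrand p s.re Z Y := by
  by_cases hY : Y.PosDef
  · rw [matrixGammaIntegrand_of_posDef _ _ hY, matrixGammaIntegrand_of_posDef _ _ hY, norm_mul,
      Complex.norm_cpow_eq_rpow_re_of_pos hY.re_det_pos, Complex.norm_real,
      Real.norm_of_nonneg (Real.exp_pos _).le, Complex.ofReal_mul,
      Complex.ofReal_cpow hY.re_det_pos.le]
    simp
  · rw [matrixGammaIntegrand_of_not_posDef _ _ hY, matrixGammaIntegrand_of_not_posDef _ _ hY]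
    simp

theorem cGammaP_ne_zero {p : ℕ} {s : ℂ} (hs : (p - 1 : ℝ) < s.re) : cGammaP p s ≠ 0 := by
  refine mul_ne_zero (pow_ne_zero _ (Complex.ofReal_ne_zero.mpr Real.pi_ne_zero))
    (Finset.prod_ne_zero_iff.mpr fun j _ => Complex.Gamma_ne_zero_of_re_pos ?_)
  have : ((j : ℕ) : ℝ) + 1 ≤ p := by exact_mod_cast j.2
  simp only [Complex.sub_re, Complex.natCast_re]
  linarith

/-- The joint integrand linking the type-2 Dirichlet integral to matrix-variate gamma integrals. -/
noncomputable def dirichletGammaIntegrand {p k : ℕ} (a : Fin k → ℂ) (b : ℂ)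
    (Y : Matrix (Fin p) (Fin p) ℂ) (X : Fin k → Matrix (Fin p) (Fin p) ℂ) : ℂ :=
  matrixGammaIntegrand p (∑ j, a j + b) 1 Y * ∏ j, matrixGammaIntegrand p (a j) Yᵀ (X j)

theorem ofReal_norm_dirichletGammaIntegrand {p k : ℕ} (a : Fin k → ℂ) (b : ℂ)
    (Y : Matrix (Fin p) (Fin p) ℂ) (X : Fin k → Matrix (Fin p) (Fin p) ℂ) :
    ((‖dirichletGammaIntegrand a b Y X‖ : ℝ) : ℂ) =
      dirichletGammaIntegrand (fun j => ((a j).re : ℂ)) b.re Y X := by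
  simp only [dirichletGammaIntegrand, norm_mul, norm_prod, Complex.ofReal_mul, Complex.ofReal_prod,
    ofReal_norm_matrixGammaIntegrand]
  simp

theorem measurable_dirichletGammaIntegrand {p k : ℕ} (a : Fin k → ℂ) (b : ℂ) :
    Measurable (Function.uncurry (dirichletGammaIntegrand (p := p) a b)) := by
  refine ((measurable_matrixGammaIntegrand p _ 1).comp measurable_fst).mul
    (Finset.measurable_prod _ fun j _ => ?_)
  have htr : Measurable fun Y : Matrix (Fin p) (Fin p) ℂ => Yᵀ :=
    Continuous.measurable (by fun_prop)
  exact (measurable_matrixGammaIntegrand_uncurry p (a j)).comp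
    ((htr.comp measurable_fst).prodMk ((measurable_pi_apply j).comp measurable_snd))

theorem integrable_dirichletGammaIntegrand_right {p k : ℕ} {a : Fin k → ℂ}
    (ha : ∀ j, (p - 1 : ℝ) < (a j).re) (b : ℂ) (Y : Matrix (Fin p) (Fin p) ℂ) :
    Integrable (dirichletGammaIntegrand a b Y) (Measure.pi fun _ => hermLebesgue p) := by
  by_cases hY : Y.PosDef
  · exact (Integrable.fintype_prod fun j =>
      integrable_matrixGammaIntegrand (ha j) hY.transpose).const_mul _
  · have : dirichletGammaIntegrand (k := k) a b Y = fun _ => 0 := by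
      funext X
      rw [dirichletGammaIntegrand, matrixGammaIntegrand_of_not_posDef _ _ hY, zero_mul]
    rw [this]
    exact integrable_zero _ _ _

theorem integral_dirichletGammaIntegrand_right {p k : ℕ} {a : Fin k → ℂ}
    (ha : ∀ j, (p - 1 : ℝ) < (a j).re) (b : ℂ) (Y : Matrix (Fin p) (Fin p) ℂ) :
    ∫ X, dirichletGammaIntegrand a b Y X ∂(Measure.pi fun _ => hermLebesgue p) =
      (∏ j, cGammaP p (a j)) * matrixGammaIntegrand p b 1 Y := by
  simp only [dirichletGammaIntegrand]
  rw [integral_const_mul, integral_fintype_prod_eq_prod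
    (fun j (X : Matrix (Fin p) (Fin p) ℂ) => matrixGammaIntegrand p (a j) Yᵀ X)]
  by_cases hY : Y.PosDef
  · simp only [fun j => integral_matrixGammaIntegrand (ha j) hY.transpose, det_transpose]
    have hd : (Y.det.re : ℂ) ≠ 0 := Complex.ofReal_ne_zero.mpr hY.re_det_pos.ne'
    have hprod : ∏ j, (Y.det.re : ℂ) ^ (-a j) = (Y.det.re : ℂ) ^ (-∑ j, a j) := by
      simp only [Complex.cpow_def_of_ne_zero hd, ← Complex.exp_sum, ← Finset.mul_sum,
        Finset.sum_neg_distrib]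
    have hsplit : (Y.det.re : ℂ) ^ (b - p) =
        (Y.det.re : ℂ) ^ (∑ j, a j + b - p) * (Y.det.re : ℂ) ^ (-∑ j, a j) := by
      rw [← Complex.cpow_add _ _ hd]
      congr 1
      ring
    rw [Finset.prod_mul_distrib, hprod, matrixGammaIntegrand_of_posDef _ _ hY,
      matrixGammaIntegrand_of_posDef _ _ hY, hsplit]
    ring
  · rw [matrixGammaIntegrand_of_not_posDef _ _ hY, matrixGammaIntegrand_of_not_posDef _ _ hY]
    simp

theorem integrable_dirichletGammaIntegrand {p k : ℕ} {a : Fin k → ℂ} {b : ℂ}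
    (ha : ∀ j, (p - 1 : ℝ) < (a j).re) (hb : (p - 1 : ℝ) < b.re) :
    Integrable (Function.uncurry (dirichletGammaIntegrand a b))
      ((hermLebesgue p).prod (Measure.pi fun _ => hermLebesgue p)) := by
  rw [integrable_prod_iff (measurable_dirichletGammaIntegrand a b).aestronglyMeasurable]
  refine ⟨ae_of_all _ (integrable_dirichletGammaIntegrand_right ha b), ?_⟩
  have hnorm : ∀ Y : Matrix (Fin p) (Fin p) ℂ,
      ∫ X, ‖dirichletGammaIntegrand a b Y X‖ ∂(Measure.pi fun _ => hermLebesgue p) =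
        ((∏ j, cGammaP p ((a j).re : ℂ)) * matrixGammaIntegrand p (b.re : ℂ) 1 Y).re := by
    intro Y
    rw [← integral_dirichletGammaIntegrand_right (a := fun j => ((a j).re : ℂ))
      (by simpa using ha) (b.re : ℂ) Y]
    simp_rw [← ofReal_norm_dirichletGammaIntegrand]
    rw [integral_complex_ofReal, Complex.ofReal_re]
  simp only [Function.uncurry_apply_pair, hnorm]
  exact ((integrable_matrixGammaIntegrand (by simpa using hb) PosDef.one).const_mul _).re

theorem dirichletGammaIntegrand_of_posDef {p k : ℕ} (a : Fin k → ℂ) (b : ℂ)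
    (Y : Matrix (Fin p) (Fin p) ℂ) {X : Fin k → Matrix (Fin p) (Fin p) ℂ}
    (hX : ∀ j, (X j).PosDef) : dirichletGammaIntegrand a b Y X =
      (∏ j, ((X j).det.re : ℂ) ^ (a j - p)) *
        matrixGammaIntegrand p (∑ j, a j + b) (1 + ∑ j, X j)ᵀ Y := by
  by_cases hY : Y.PosDef
  · have hexp : (Real.exp (-(((1 + ∑ j, X j)ᵀ)ᵀ * Y).trace.re) : ℂ) =
        (Real.exp (-(1ᵀ * Y).trace.re) : ℂ) *
          ∏ j, (Real.exp (-((Yᵀ)ᵀ * X j).trace.re) : ℂ) := by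
      rw [← Complex.ofReal_prod, ← Real.exp_sum, ← Complex.ofReal_mul, ← Real.exp_add]
      simp only [transpose_transpose, transpose_one, Matrix.add_mul, Matrix.sum_mul, trace_add,
        trace_sum, Complex.add_re, Complex.re_sum, Finset.sum_neg_distrib, neg_add,
        fun j => trace_mul_comm (X j) Y]
    simp only [dirichletGammaIntegrand, matrixGammaIntegrand_of_posDef _ _ hY,
      fun j => matrixGammaIntegrand_of_posDef (a j) Yᵀ (hX j), hexp, Finset.prod_mul_distrib]
    ring
  · rw [dirichletGammaIntegrand, matrixGammaIntegrand_of_not_posDef _ _ hY,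
      matrixGammaIntegrand_of_not_posDef _ _ hY, zero_mul, mul_zero]

theorem dirichletGammaIntegrand_of_not_posDef {p k : ℕ} (a : Fin k → ℂ) (b : ℂ)
    (Y : Matrix (Fin p) (Fin p) ℂ) {X : Fin k → Matrix (Fin p) (Fin p) ℂ}
    (hX : ¬ ∀ j, (X j).PosDef) : dirichletGammaIntegrand a b Y X = 0 := by
  obtain ⟨j, hj⟩ := not_forall.mp hX
  rw [dirichletGammaIntegrand, Finset.prod_eq_zero (Finset.mem_univ j)
    (matrixGammaIntegrand_of_not_posDef _ _ hj), mul_zero]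

theorem posDef_one_add_sum {p k : ℕ} {X : Fin k → Matrix (Fin p) (Fin p) ℂ}
    (hX : ∀ j, (X j).PosDef) : (1 + ∑ j, X j).PosDef :=
  PosDef.one.add_posSemidef (posSemidef_sum _ fun j _ => (hX j).posSemidef)

theorem measurableSet_forall_posDef (p k : ℕ) :
    MeasurableSet {X : Fin k → Matrix (Fin p) (Fin p) ℂ | ∀ j, (X j).PosDef} := by
  have h : {X : Fin k → Matrix (Fin p) (Fin p) ℂ | ∀ j, (X j).PosDef} =
      ⋂ j, (fun X : Fin k → Matrix (Fin p) (Fin p) ℂ => X j) ⁻¹' {Y | Y.PosDef} := by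
    ext X
    simp
  rw [h]
  exact MeasurableSet.iInter fun j => (measurable_pi_apply j) (measurableSet_posDef p)

/-- The type-2 Dirichlet integral over tuples of positive definite matrices. -/
theorem setIntegral_dirichlet {p k : ℕ} (hp : 1 ≤ p) {a : Fin k → ℂ} {b : ℂ}
    (ha : ∀ j, (p - 1 : ℝ) < (a j).re) (hb : (p - 1 : ℝ) < b.re) :
    cGammaP p (∑ j, a j + b) *
      ∫ X in {X : Fin k → Matrix (Fin p) (Fin p) ℂ | ∀ j, (X j).PosDef},
        (∏ j, ((X j).det.re : ℂ) ^ (a j - p)) *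
          ((1 + ∑ j, X j).det.re : ℂ) ^ (-(∑ j, a j + b))
        ∂(Measure.pi fun _ : Fin k => hermLebesgue p) =
      (∏ j, cGammaP p (a j)) * cGammaP p b := by
  have hs : (p - 1 : ℝ) < (∑ j, a j + b).re := by
    have hp' : (1 : ℝ) ≤ p := by exact_mod_cast hp
    have : 0 ≤ ∑ j, (a j).re := Finset.sum_nonneg fun j _ => by linarith [ha j]
    rw [Complex.add_re, Complex.re_sum]
    linarith
  have hswap := integral_integral_swap (integrable_dirichletGammaIntegrand ha hb)
  simp only [integral_dirichletGammaIntegrand_right ha b] at hswap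
  rw [integral_const_mul, integral_matrixGammaIntegrand hb PosDef.one] at hswap
  simp only [det_one, Complex.one_re, Complex.ofReal_one, Complex.one_cpow, mul_one] at hswap
  rw [hswap, ← integral_const_mul, ← integral_indicator (measurableSet_forall_posDef p k)]
  refine integral_congr_ae (ae_of_all _ fun X => ?_)
  by_cases hX : ∀ j, (X j).PosDef
  · rw [Set.indicator_of_mem (by exact hX)]
    simp only [dirichletGammaIntegrand_of_posDef a b _ hX]
    rw [integral_const_mul, integral_matrixGammaIntegrand hs (posDef_one_add_sum hX).transpose,
      det_transpose]
    ring
  · rw [Set.indicator_of_notMem (by exact hX)]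
    simp only [dirichletGammaIntegrand_of_not_posDef a b _ hX, integral_zero]

theorem stmt14 (p k : ℕ) (hp : 1 ≤ p) (hk : 1 ≤ k)
    (α : Fin (k + 1) → ℂ) (δ : ℂ)
    (hα : ∀ j, (p - 1 : ℝ) < (α j).re)
    (hδ : (p - 1 : ℝ) < (α (Fin.last k) + δ).re) :
    ∫ X in {X : Fin k → Matrix (Fin p) (Fin p) ℂ | ∀ j, (X j).PosDef},
      ((((1 + ∑ j, X j).det.re : ℂ) ^ (-δ)) *
        ((cGammaP p (∑ j, α j) / ∏ j : Fin (k + 1), cGammaP p (α j)) *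
          (∏ j : Fin k, ((X j).det.re : ℂ) ^ (α j.castSucc - p)) *
          (((1 + ∑ j, X j).det.re : ℂ) ^ (-(∑ j, α j)))))
      ∂(Measure.pi fun _ : Fin k => hermLebesgue p)
    = (cGammaP p (α (Fin.last k) + δ) / cGammaP p (α (Fin.last k))) *
        cGammaP p (∑ j, α j) / cGammaP p ((∑ j, α j) + δ) := by
  have hinteg := setIntegral_dirichlet hp (fun j : Fin k => hα j.castSucc) hδ
  have hsum : ∑ j : Fin k, α j.castSucc + (α (Fin.last k) + δ) = ∑ j, α j + δ := by
    rw [Fin.sum_univ_castSucc, add_assoc]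
  have hs : (p - 1 : ℝ) < (∑ j, α j + δ).re := by
    have hp' : (1 : ℝ) ≤ p := by exact_mod_cast hp
    have : 0 ≤ ∑ j : Fin k, (α j.castSucc).re :=
      Finset.sum_nonneg fun j _ => by linarith [hα j.castSucc]
    rw [← hsum, Complex.add_re, Complex.re_sum]
    linarith
  rw [hsum] at hinteg
  have hpoint : ∀ X ∈ {X : Fin k → Matrix (Fin p) (Fin p) ℂ | ∀ j, (X j).PosDef},
      ((((1 + ∑ j, X j).det.re : ℂ) ^ (-δ)) *
        ((cGammaP p (∑ j, α j) / ∏ j : Fin (k + 1), cGammaP p (α j)) *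
          (∏ j : Fin k, ((X j).det.re : ℂ) ^ (α j.castSucc - p)) *
          (((1 + ∑ j, X j).det.re : ℂ) ^ (-(∑ j, α j))))) =
      (cGammaP p (∑ j, α j) / ∏ j : Fin (k + 1), cGammaP p (α j)) *
        ((∏ j : Fin k, ((X j).det.re : ℂ) ^ (α j.castSucc - p)) *
          ((1 + ∑ j, X j).det.re : ℂ) ^ (-(∑ j, α j + δ))) := by
    intro X hX
    rw [neg_add, Complex.cpow_add _ _
      (Complex.ofReal_ne_zero.mpr (posDef_one_add_sum hX).re_det_pos.ne')]
    ring
  rw [setIntegral_congr_fun (measurableSet_forall_posDef p k) hpoint, integral_const_mul,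
    eq_div_of_mul_eq (cGammaP_ne_zero hs) ((mul_comm _ _).trans hinteg), Fin.prod_univ_castSucc]
  have h1 := cGammaP_ne_zero hs
  have h2 := cGammaP_ne_zero (hα (Fin.last k))
  have h3 : ∏ j : Fin k, cGammaP p (α j.castSucc) ≠ 0 :=
    Finset.prod_ne_zero_iff.mpr fun j _ => cGammaP_ne_zero (hα j.castSucc)
  field_simp
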